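/- Let n ≥ 7 be an integer and, for p = 1, …, ⌊(n−4)/2⌋, let T_p = T(p, n−2p−3, p) be the caterpillar of order n. Set r = (2n − 3 − √(2n(n−2)+3))/2 and s = (2(n−1) − √(2n(n−1)))/2. Then RE(T_1) ≤ RE(T_p) for every p ∈ {1, …, ⌊(n−4)/2⌋}, and there exists an integer z with round(r) ≤ z ≤ round(s) and 1 ≤ z ≤ ⌊(n−4)/2⌋ such that RE(T_p) ≤ RE(T_z) for every p ∈ {1, …, ⌊(n−4)/2⌋}. -/

import Mathlib

open Polynomial

open scoped Classical in
/-- The Randić matrix of a simple graph `G`: the `(u,v)` entry is `1/√(d_u d_v)` when `uv` is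
an edge and `0` otherwise, where `d_v` is the degree of the vertex `v`. -/
noncomputable def randicMatrix {V : Type*} (G : SimpleGraph V) : Matrix V V ℝ :=
  Matrix.of fun u v =>
    if G.Adj u v then
      1 / Real.sqrt (((G.neighborSet u).ncard : ℝ) * ((G.neighborSet v).ncard : ℝ))
    else 0

lemma randicMatrix_isHermitian {V : Type*} (G : SimpleGraph V) :
    (randicMatrix G).IsHermitian := by
  ext u v
  by_cases h : G.Adj u v
  · simp [randicMatrix, Matrix.conjTranspose_apply, h, h.symm, mul_comm]
  · have h' : ¬ G.Adj v u := fun hc => h hc.symm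
    simp [randicMatrix, Matrix.conjTranspose_apply, h, h']

/-- The Randić energy of a graph: the sum of the absolute values of the eigenvalues of its
Randić matrix. -/
noncomputable def randicEnergy {V : Type*} [Fintype V] [DecidableEq V] (G : SimpleGraph V) : ℝ :=
  ∑ i, |(randicMatrix_isHermitian G).eigenvalues i|

/-- The caterpillar `T(p 0, …, p (r-1))`: a path `v_0 v_1 ⋯ v_{r-1}` (the `Sum.inl` vertices)
together with, for each `i`, `p i` pendant vertices attached to `v_i` (the `Sum.inr` vertices). -/
def caterpillar (r : ℕ) (p : Fin r → ℕ) :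
    SimpleGraph ((Fin r) ⊕ (Σ i : Fin r, Fin (p i))) :=
  SimpleGraph.fromRel (fun u v =>
    (∃ i j : Fin r, u = Sum.inl i ∧ v = Sum.inl j ∧ (i : ℕ) + 1 = (j : ℕ)) ∨
    (∃ (i : Fin r) (k : Fin (p i)), u = Sum.inl i ∧ v = Sum.inr ⟨i, k⟩))


lemma caterpillar_adj_inl_inl {r : ℕ} {p : Fin r → ℕ} (i j : Fin r) :
    (caterpillar r p).Adj (Sum.inl i) (Sum.inl j) ↔
      (i : ℕ) + 1 = j ∨ (j : ℕ) + 1 = i := by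
  simp only [caterpillar, SimpleGraph.fromRel_adj, ne_eq, Sum.inl.injEq, reduceCtorEq, and_false,
    exists_false, or_false]
  constructor
  · rintro ⟨-, ⟨a, b, rfl, rfl, h⟩ | ⟨a, b, rfl, rfl, h⟩⟩ <;> omega
  · intro h
    refine ⟨by rintro rfl; omega, ?_⟩
    rcases h with h | h
    · exact Or.inl ⟨i, j, rfl, rfl, h⟩
    · exact Or.inr ⟨j, i, rfl, rfl, h⟩

lemma caterpillar_adj_inl_inr {r : ℕ} {p : Fin r → ℕ} (i : Fin r) (j : Σ i : Fin r, Fin (p i)) :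
    (caterpillar r p).Adj (Sum.inl i) (Sum.inr j) ↔ i = j.1 := by
  simp only [caterpillar, SimpleGraph.fromRel_adj]
  constructor
  · rintro ⟨-, (⟨a, b, h, h', -⟩ | ⟨a, b, h, h'⟩) | (⟨a, b, h, h', -⟩ | ⟨a, b, h, h'⟩)⟩ <;> cases h
    all_goals cases h'
    rfl
  · rintro rfl
    exact ⟨by simp, Or.inl (Or.inr ⟨j.1, j.2, rfl, rfl⟩)⟩

lemma caterpillar_not_adj_inr_inr {r : ℕ} {p : Fin r → ℕ} (i j : Σ i : Fin r, Fin (p i)) :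
    ¬ (caterpillar r p).Adj (Sum.inr i) (Sum.inr j) := by
  simp [caterpillar, SimpleGraph.fromRel_adj]

lemma caterpillar_ncard_neighborSet_inr {r : ℕ} {p : Fin r → ℕ} (j : Σ i : Fin r, Fin (p i)) :
    ((caterpillar r p).neighborSet (Sum.inr j)).ncard = 1 := by
  rw [Set.ncard_eq_one]
  refine ⟨Sum.inl j.1, ?_⟩
  ext (i | k)
  · simp [SimpleGraph.adj_comm _ (Sum.inr j), caterpillar_adj_inl_inr]
  · simp [caterpillar_not_adj_inr_inr]

lemma caterpillar_ncard_neighborSet_inl {r : ℕ} {p : Fin r → ℕ} (i : Fin r) :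
    ((caterpillar r p).neighborSet (Sum.inl i)).ncard =
      (Finset.univ.filter fun j : Fin r => (i : ℕ) + 1 = j ∨ (j : ℕ) + 1 = i).card + p i := by
  have h : (caterpillar r p).neighborSet (Sum.inl i) =
      Sum.inl '' {j : Fin r | (i : ℕ) + 1 = j ∨ (j : ℕ) + 1 = i} ∪
        Set.range fun k : Fin (p i) => Sum.inr ⟨i, k⟩ := by
    ext (j | ⟨j, k⟩)
    · simp [caterpillar_adj_inl_inl]
    · simp only [SimpleGraph.mem_neighborSet, caterpillar_adj_inl_inr, Set.mem_union,
        Set.mem_image, reduceCtorEq, and_false, exists_false, Set.mem_range, Sum.inr.injEq,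
        false_or]
      constructor
      · rintro rfl
        exact ⟨k, rfl⟩
      · rintro ⟨l, hl⟩
        cases hl
        rfl
  rw [h, Set.ncard_union_eq, Set.ncard_image_of_injective _ Sum.inl_injective]
  · congr 1
    · rw [← Set.ncard_coe_finset]
      simp
    · rw [Set.ncard_range_of_injective, Nat.card_eq_fintype_card, Fintype.card_fin]
      intro a b hab
      simpa using hab
  · rw [Set.disjoint_left]
    rintro _ ⟨j, -, rfl⟩ ⟨k, hk⟩
    cases hk

/-- The Randić matrix of a symmetric three-spine caterpillar, in block form. -/
lemma randicMatrix_caterpillar_three (p q : ℕ) :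
    randicMatrix (caterpillar 3 ![p, q, p]) =
      Matrix.fromBlocks
        (!![0, 1 / √(((p : ℝ) + 1) * (q + 2)), 0;
          1 / √(((p : ℝ) + 1) * (q + 2)), 0, 1 / √(((p : ℝ) + 1) * (q + 2));
          0, 1 / √(((p : ℝ) + 1) * (q + 2)), 0])
        (Matrix.of fun i j => if i = j.1 then 1 / √(![(p : ℝ) + 1, q + 2, p + 1] i) else 0)
        (Matrix.of fun j i => if i = j.1 then 1 / √(![(p : ℝ) + 1, q + 2, p + 1] i) else 0)
        0 := by
  have hd : ∀ i : Fin 3, (((caterpillar 3 ![p, q, p]).neighborSet (Sum.inl i)).ncard : ℝ) =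
      ![(p : ℝ) + 1, q + 2, p + 1] i := by
    intro i
    rw [caterpillar_ncard_neighborSet_inl]
    have h0 : (Finset.univ.filter fun j : Fin 3 =>
      ((0 : Fin 3) : ℕ) + 1 = j ∨ (j : ℕ) + 1 = (0 : Fin 3)).card = 1 := by decide
    have h1 : (Finset.univ.filter fun j : Fin 3 =>
      ((1 : Fin 3) : ℕ) + 1 = j ∨ (j : ℕ) + 1 = (1 : Fin 3)).card = 2 := by decide
    have h2 : (Finset.univ.filter fun j : Fin 3 =>
      ((2 : Fin 3) : ℕ) + 1 = j ∨ (j : ℕ) + 1 = (2 : Fin 3)).card = 1 := by decide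
    match i with
    | 0 => rw [h0]; simp [add_comm]
    | 1 => rw [h1]; simp [add_comm]
    | 2 => rw [h2]; simp [add_comm]
  ext (i | i) (j | j)
  · simp only [randicMatrix, Matrix.of_apply, Matrix.fromBlocks_apply₁₁, hd,
      caterpillar_adj_inl_inl]
    fin_cases i <;> fin_cases j <;> simp [mul_comm]
  · simp only [randicMatrix, Matrix.of_apply, Matrix.fromBlocks_apply₁₂, hd,
      caterpillar_adj_inl_inr, caterpillar_ncard_neighborSet_inr, Nat.cast_one, mul_one]
  · simp only [randicMatrix, Matrix.of_apply, Matrix.fromBlocks_apply₂₁, hd,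
      SimpleGraph.adj_comm _ (Sum.inr i), caterpillar_adj_inl_inr,
      caterpillar_ncard_neighborSet_inr, Nat.cast_one, one_mul]
  · simp only [randicMatrix, Matrix.of_apply, Matrix.fromBlocks_apply₂₂,
      caterpillar_not_adj_inr_inr, if_false, Matrix.zero_apply]

lemma eval_charpoly_randicMatrix_caterpillar_three (p q : ℕ) {x : ℝ} (hx : x ≠ 0) :
    x ^ 3 * (randicMatrix (caterpillar 3 ![p, q, p])).charpoly.eval x =
      x ^ (2 * p + q) * ((x ^ 2 - 1) * (x ^ 2 - p / (p + 1)) *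
        (x ^ 2 - p / (p + 1) * (q / (q + 2)))) := by
  have hp : (0 : ℝ) < p + 1 := by positivity
  have hq : (0 : ℝ) < q + 2 := by positivity
  set c := 1 / √(((p : ℝ) + 1) * (q + 2)) with hc
  have hc2 : c ^ 2 = 1 / ((p + 1) * (q + 2)) := by
    rw [hc, div_pow, Real.sq_sqrt (by positivity), one_pow]
  set B : Matrix (Fin 3) (Σ i : Fin 3, Fin (![p, q, p] i)) ℝ :=
    Matrix.of fun i j => if i = j.1 then 1 / √(![(p : ℝ) + 1, q + 2, p + 1] i) else 0 with hB
  have hBB : B * B.transpose = Matrix.diagonal ![(p : ℝ) / (p + 1), q / (q + 2), p / (p + 1)] := by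
    ext i j
    rw [Matrix.mul_apply, Fintype.sum_sigma]
    have hs : ∀ t : ℝ, 0 < t → (√t)⁻¹ * (√t)⁻¹ = t⁻¹ := fun t ht => by
      rw [← mul_inv, Real.mul_self_sqrt ht.le]
    fin_cases i <;> fin_cases j <;>
      simp [hB, hs _ hp, hs _ hq, div_eq_mul_inv]
  have hsplit : Matrix.scalar _ x - randicMatrix (caterpillar 3 ![p, q, p]) =
      Matrix.fromBlocks (Matrix.scalar _ x - !![0, c, 0; c, 0, c; 0, c, 0]) (-B) (-B.transpose)
        (Matrix.scalar _ x) := by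
    rw [randicMatrix_caterpillar_three]
    ext (i | i) (j | j) <;> simp [Matrix.diagonal_apply, hB, hc]
  let hinv : Invertible (Matrix.scalar (Σ i : Fin 3, Fin (![p, q, p] i)) x) :=
    ⟨Matrix.scalar _ x⁻¹, by rw [← map_mul, inv_mul_cancel₀ hx, map_one],
      by rw [← map_mul, mul_inv_cancel₀ hx, map_one]⟩
  have hinv' : ⅟ (Matrix.scalar (Σ i : Fin 3, Fin (![p, q, p] i)) x) = Matrix.scalar _ x⁻¹ := rfl
  have hschur : -B * ⅟ (Matrix.scalar (Σ i : Fin 3, Fin (![p, q, p] i)) x) * -B.transpose =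
      x⁻¹ • Matrix.diagonal ![(p : ℝ) / (p + 1), q / (q + 2), p / (p + 1)] := by
    rw [hinv', ← hBB, Matrix.scalar_apply, ← Matrix.smul_one_eq_diagonal]
    simp
  rw [Matrix.eval_charpoly, hsplit, Matrix.det_fromBlocks₂₂, hschur]
  have hdet : (Matrix.scalar (Σ i : Fin 3, Fin (![p, q, p] i)) x).det = x ^ (2 * p + q) := by
    rw [Matrix.scalar_apply, Matrix.det_diagonal, Finset.prod_const, Finset.card_univ]
    simp [Fin.sum_univ_three]
    ring
  rw [hdet, Matrix.det_fin_three]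
  simp only [Matrix.sub_apply, Matrix.smul_apply, Matrix.scalar_apply, Matrix.diagonal_apply]
  simp
  have hc3 : c ^ 2 = (1 - p / (p + 1)) * (1 - q / (q + 2)) / 2 := by
    rw [hc2]; field_simp; ring
  generalize (p : ℝ) / (p + 1) = a at *
  generalize (q : ℝ) / (q + 2) = b at *
  trans x ^ (2 * p + q) * ((x ^ 2 - a) * ((x ^ 2 - a) * (x ^ 2 - b) - 2 * c ^ 2 * x ^ 2))
  · field_simp
    ring
  · rw [hc3]
    ring

lemma randicEnergy_caterpillar_three (p q : ℕ) :
    randicEnergy (caterpillar 3 ![p, q, p]) =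
      2 + 2 * (√((p : ℝ) / (p + 1)) * (1 + √((q : ℝ) / (q + 2)))) := by
  set g := √((p : ℝ) / (p + 1)) with hg
  set k := √((q : ℝ) / (q + 2)) with hk
  have hg2 : g ^ 2 = (p : ℝ) / (p + 1) := Real.sq_sqrt (by positivity)
  have hk2 : k ^ 2 = (q : ℝ) / (q + 2) := Real.sq_sqrt (by positivity)
  have hg0 : 0 ≤ g := Real.sqrt_nonneg _
  have hk0 : 0 ≤ k := Real.sqrt_nonneg _
  set M := randicMatrix (caterpillar 3 ![p, q, p])
  set S : Multiset ℝ := Multiset.replicate (2 * p + q) 0 + {1, -1, g, -g, g * k, -(g * k)} with hS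
  have hpoly : X ^ 3 * M.charpoly = (S.map fun a => X - C a).prod := by
    refine Polynomial.eq_of_infinite_eval_eq _ _ (Set.Infinite.mono (s := {0}ᶜ) ?_ ?_)
    · intro x hx
      simp only [Set.mem_ofPred_eq, eval_mul, eval_pow, eval_X]
      rw [eval_charpoly_randicMatrix_caterpillar_three p q hx, ← hg2, ← hk2]
      simp [hS]
      ring
    · exact (Set.finite_singleton 0).infinite_compl
  have hroots := congrArg roots hpoly
  rw [roots_multiset_prod_X_sub_C,
    roots_mul (mul_ne_zero (pow_ne_zero _ X_ne_zero) M.charpoly_monic.ne_zero), roots_pow, roots_X,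
    (randicMatrix_isHermitian _).roots_charpoly_eq_eigenvalues] at hroots
  have hsum := congrArg (fun s : Multiset ℝ => (s.map fun a => |a|).sum) hroots
  simp [hS, abs_of_nonneg, hg0, hk0, mul_nonneg, Multiset.map_nsmul, Multiset.sum_nsmul] at hsum
  rw [randicEnergy, Fintype.sum_sum_type]
  linarith

/-- The part of the Randić energy of `T(p, q, p)` that depends on the parameters. -/
noncomputable def energyProfile (p q : ℝ) : ℝ := √(p / (p + 1)) * (1 + √(q / (q + 2)))

/-- The sign of the increment of `energyProfile` along a step `(p, q) ↦ (p + 1, q - 2)`. -/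
lemma energyProfile_increment {p q : ℝ} (hp : 0 < p) (hq : 2 < q) :
    ∃ c > 0, c * (energyProfile (p + 1) (q - 2) - energyProfile p q) =
      √(p / (p + 1)) * (√(q / (q + 2)) * (q * (q + 2)) - (4 * (p + 1) ^ 2 - q ^ 2)) +
      √((p + 1) / (p + 2)) *
        (√((q - 2) / q) * (q * (q + 2)) - (4 * (p + 1) ^ 2 - q ^ 2)) := by
  have e1 : energyProfile (p + 1) (q - 2) = √((p + 1) / (p + 2)) * (1 + √((q - 2) / q)) := by
    rw [energyProfile]; ring_nf
  have hq0 : 0 < q := by linarith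
  have hq2 : 0 < q - 2 := by linarith
  rw [e1, energyProfile]
  have hg : 0 < √(p / (p + 1)) := Real.sqrt_pos.2 (by positivity)
  have hk : 0 < √(q / (q + 2)) := Real.sqrt_pos.2 (by positivity)
  have hg' : 0 < √((p + 1) / (p + 2)) := Real.sqrt_pos.2 (by positivity)
  have hk' : 0 < √((q - 2) / q) := Real.sqrt_pos.2 (by positivity)
  have hg2 : √(p / (p + 1)) ^ 2 = p / (p + 1) := Real.sq_sqrt (by positivity)
  have hk2 : √(q / (q + 2)) ^ 2 = q / (q + 2) := Real.sq_sqrt (by positivity)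
  have hg2' : √((p + 1) / (p + 2)) ^ 2 = (p + 1) / (p + 2) := Real.sq_sqrt (by positivity)
  have hk2' : √((q - 2) / q) ^ 2 = (q - 2) / q := Real.sq_sqrt (by positivity)
  set g := √(p / (p + 1))
  set k := √(q / (q + 2))
  set g' := √((p + 1) / (p + 2))
  set k' := √((q - 2) / q)
  refine ⟨(p + 1) * (p + 2) * (q * (q + 2)) * (g + g') * (g * k + g' * k'), by positivity, ?_⟩
  have hX : (p + 1) * (p + 2) * (g' ^ 2 - g ^ 2) = 1 := by
    rw [hg2, hg2']; field_simp; ring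
  have hY : (p + 1) * (p + 2) * (q * (q + 2)) * (g ^ 2 * k ^ 2 - g' ^ 2 * k' ^ 2) =
      4 * (p + 1) ^ 2 - q ^ 2 := by
    rw [hg2, hg2', hk2, hk2']; field_simp; ring
  linear_combination (q * (q + 2)) * (g * k + g' * k') * hX - (g + g') * hY

lemma energyProfile_lt_step {p q : ℝ} (hp : 0 < p) (hq : 3 ≤ q)
    (h : 4 * (p + 1) ^ 2 + 1 ≤ 2 * q ^ 2) :
    energyProfile p q < energyProfile (p + 1) (q - 2) := by
  obtain ⟨c, hc, hinc⟩ := energyProfile_increment hp (by linarith : 2 < q)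
  have hq0 : 0 < q := by linarith
  have hg : 0 < √(p / (p + 1)) := Real.sqrt_pos.2 (by positivity)
  have hg' : 0 < √((p + 1) / (p + 2)) := Real.sqrt_pos.2 (by positivity)
  have hkk : √((q - 2) / q) ≤ √(q / (q + 2)) := by
    apply Real.sqrt_le_sqrt
    rw [div_le_div_iff₀ hq0 (by positivity)]
    nlinarith
  have hk' : (q ^ 2 - 1) / (q * (q + 2)) < √((q - 2) / q) := by
    apply Real.lt_sqrt_of_sq_lt
    rw [div_pow, div_lt_div_iff₀ (by positivity) hq0]
    nlinarith [mul_pos hq0 (mul_pos hq0 (mul_pos hq0 hq0)), mul_pos hq0 hq0,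
      mul_nonneg (mul_pos hq0 hq0).le (sub_nonneg.2 hq), mul_nonneg hq0.le (sub_nonneg.2 hq),
      mul_nonneg (mul_pos hq0 (mul_pos hq0 hq0)).le (sub_nonneg.2 hq)]
  rw [div_lt_iff₀ (by positivity)] at hk'
  have hqq : 0 < q * (q + 2) := by positivity
  have hk := mul_le_mul_of_nonneg_right hkk hqq.le
  have h1 : 0 < c * (energyProfile (p + 1) (q - 2) - energyProfile p q) := by
    rw [hinc]
    exact add_pos (mul_pos hg (by linarith)) (mul_pos hg' (by linarith))
  linarith [pos_of_mul_pos_right h1 hc.le]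

lemma energyProfile_step_lt {p q : ℝ} (hp : 0 < p) (hq : 3 ≤ q)
    (h : 2 * q ^ 2 + 2 * q + 1 < 4 * (p + 1) ^ 2) :
    energyProfile (p + 1) (q - 2) < energyProfile p q := by
  obtain ⟨c, hc, hinc⟩ := energyProfile_increment hp (by linarith : 2 < q)
  have hq0 : 0 < q := by linarith
  have hg : 0 < √(p / (p + 1)) := Real.sqrt_pos.2 (by positivity)
  have hg' : 0 < √((p + 1) / (p + 2)) := Real.sqrt_pos.2 (by positivity)
  have hqq : 0 < q * (q + 2) := by positivity
  have hk : √(q / (q + 2)) ≤ 1 :=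
    Real.sqrt_le_one.2 ((div_le_one (by positivity)).2 (by linarith))
  have hk' : √((q - 2) / q) ≤ 1 := Real.sqrt_le_one.2 ((div_le_one hq0).2 (by linarith))
  have hk := mul_le_mul_of_nonneg_right hk hqq.le
  have hk' := mul_le_mul_of_nonneg_right hk' hqq.le
  have h1 : c * (energyProfile (p + 1) (q - 2) - energyProfile p q) < 0 := by
    rw [hinc]
    exact add_neg (mul_neg_of_pos_of_neg hg (by linarith)) (mul_neg_of_pos_of_neg hg' (by linarith))
  linarith [neg_of_mul_neg_right h1 hc.le]

/-- Away from the boundary `q = 1`, both summands of the profile are minimal at `p = 1`. -/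
lemma energyProfile_one_le_of_two_le {p q : ℝ} (hp : 1 ≤ p) (hq : 2 ≤ q) :
    energyProfile 1 (q + 2 * p - 2) ≤ energyProfile p q := by
  have h1 : √((1 : ℝ) / (1 + 1)) ≤ √(p / (p + 1)) := by
    apply Real.sqrt_le_sqrt
    rw [div_le_div_iff₀ (by positivity) (by positivity)]
    linarith
  have h2 : √((1 : ℝ) / (1 + 1)) * √((q + 2 * p - 2) / (q + 2 * p - 2 + 2)) ≤
      √(p / (p + 1)) * √(q / (q + 2)) := by
    rw [← Real.sqrt_mul (by positivity), ← Real.sqrt_mul (by positivity)]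
    apply Real.sqrt_le_sqrt
    rw [div_mul_div_comm, div_mul_div_comm,
      div_le_div_iff₀ (mul_pos (by norm_num) (by linarith)) (by positivity)]
    nlinarith [mul_nonneg (sub_nonneg.2 hp) (sub_nonneg.2 hq),
      mul_nonneg (mul_nonneg (sub_nonneg.2 hp) (sub_nonneg.2 hq)) (by linarith : 0 ≤ q + 2 * p)]
  rw [energyProfile, energyProfile, mul_add, mul_add, mul_one, mul_one]
  exact add_le_add h1 h2

lemma energyProfile_one_le_of_eq_one {p : ℝ} (hp : 2 ≤ p) :
    energyProfile 1 (2 * p - 1) ≤ energyProfile p 1 := by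
  have hk : √((2 * p - 1) / (2 * p - 1 + 2)) ≤ 2 * p / (2 * p + 1) := by
    apply Real.sqrt_le_iff.2 ⟨by positivity, _⟩
    rw [div_pow, div_le_div_iff₀ (by linarith) (by positivity)]
    nlinarith
  have hs : (1.154 / 2 : ℝ) ≤ √(1 / (1 + 2)) := by
    apply Real.le_sqrt_of_sq_le
    norm_num
  have h3 : (1 + √((1 : ℝ) / (1 + 2))) ≥ 1.577 := by linarith
  rw [energyProfile, energyProfile]
  calc √((1 : ℝ) / (1 + 1)) * (1 + √((2 * p - 1) / (2 * p - 1 + 2)))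
      ≤ √((1 : ℝ) / (1 + 1)) * (1 + 2 * p / (2 * p + 1)) := by gcongr
    _ ≤ √(p / (p + 1)) * 1.577 := by
      refine (sq_le_sq₀ (by positivity) (by positivity)).1 ?_
      rw [mul_pow, mul_pow, Real.sq_sqrt (by norm_num), Real.sq_sqrt (by positivity)]
      have e : (1 + 2 * p / (2 * p + 1)) = (4 * p + 1) / (2 * p + 1) := by field_simp; ring
      rw [e, div_pow, div_mul_div_comm, div_mul_eq_mul_div,
        div_le_div_iff₀ (by positivity) (by positivity)]
      nlinarith [mul_nonneg (by linarith : 0 ≤ p) (sub_nonneg.2 hp),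
        mul_nonneg (mul_nonneg (by linarith : 0 ≤ p) (by linarith : 0 ≤ p)) (sub_nonneg.2 hp)]
    _ ≤ √(p / (p + 1)) * (1 + √((1 : ℝ) / (1 + 2))) := by gcongr

/-- Let `n ≥ 7` and, for `p = 1, …, ⌊(n-4)/2⌋`, let
`T_p = T(p, n-2p-3, p)` be the caterpillar of order `n`.  With
`r = (2n - 3 - √(2n(n-2)+3))/2` and `s = (2(n-1) - √(2n(n-1)))/2`, one has
`RE(T_1) ≤ RE(T_p)` for all such `p`, and there is an integer `z` with
`round r ≤ z ≤ round s`, `1 ≤ z ≤ ⌊(n-4)/2⌋` and `RE(T_p) ≤ RE(T_z)` for all such `p`. -/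
theorem caterpillar3_extremal_symmetric (n : ℕ) (hn : 7 ≤ n) :
    (∀ p : ℕ, 1 ≤ p → p ≤ (n - 4) / 2 →
      randicEnergy (caterpillar 3 ![1, n - 2 * 1 - 3, 1])
        ≤ randicEnergy (caterpillar 3 ![p, n - 2 * p - 3, p])) ∧
    ∃ z : ℕ,
      round ((2 * (n : ℝ) - 3 - Real.sqrt (2 * (n : ℝ) * ((n : ℝ) - 2) + 3)) / 2) ≤ (z : ℤ) ∧
      (z : ℤ) ≤ round ((2 * ((n : ℝ) - 1) - Real.sqrt (2 * (n : ℝ) * ((n : ℝ) - 1))) / 2) ∧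
      1 ≤ z ∧ z ≤ (n - 4) / 2 ∧
      ∀ p : ℕ, 1 ≤ p → p ≤ (n - 4) / 2 →
        randicEnergy (caterpillar 3 ![p, n - 2 * p - 3, p])
          ≤ randicEnergy (caterpillar 3 ![z, n - 2 * z - 3, z]) := by
  have hcast : ∀ p : ℕ, 1 ≤ p → p ≤ (n - 4) / 2 →
      ((n - 2 * p - 3 : ℕ) : ℝ) = n - 2 * p - 3 := fun p _ hp => by
    have h : n - 2 * p - 3 + (2 * p + 3) = n := by omega
    have h' : ((n - 2 * p - 3 : ℕ) : ℝ) + (2 * p + 3) = n := by exact_mod_cast h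
    linarith
  have henergy : ∀ p : ℕ, 1 ≤ p → p ≤ (n - 4) / 2 →
      randicEnergy (caterpillar 3 ![p, n - 2 * p - 3, p]) =
        2 + 2 * energyProfile p (n - 2 * p - 3) := fun p h1 h2 => by
    rw [randicEnergy_caterpillar_three, energyProfile, hcast p h1 h2]
  have hnR : (7 : ℝ) ≤ n := by exact_mod_cast hn
  constructor
  · intro p h1 h2
    rw [henergy p h1 h2, henergy 1 le_rfl (by omega), Nat.cast_one]
    have h1R : (1 : ℝ) ≤ p := by exact_mod_cast h1
    suffices h : energyProfile 1 (n - 2 * 1 - 3) ≤ energyProfile p (n - 2 * p - 3) by linarith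
    rcases h1.eq_or_lt with rfl | h1
    · simp
    by_cases hq : n = 2 * p + 4
    · have hqR : (n : ℝ) = 2 * p + 4 := by exact_mod_cast hq
      convert energyProfile_one_le_of_eq_one (p := p) (by exact_mod_cast h1) using 2 <;> linarith
    · have hqR : (2 : ℝ) * p + 5 ≤ n := by
        have h : 2 * p + 5 ≤ n := by omega
        exact_mod_cast h
      convert energyProfile_one_le_of_two_le h1R (q := n - 2 * p - 3) (by linarith) using 2
      ring
  · obtain ⟨z, hz, hmax⟩ := Finset.exists_max_image (Finset.Icc 1 ((n - 4) / 2))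
      (fun p : ℕ => energyProfile p (n - 2 * p - 3)) ⟨1, Finset.mem_Icc.2 (by omega)⟩
    obtain ⟨hz1, hz2⟩ := Finset.mem_Icc.1 hz
    have hz1R : (1 : ℝ) ≤ z := by exact_mod_cast hz1
    have hzn : (2 : ℝ) * z + 4 ≤ n := by
      have h : 2 * z + 4 ≤ n := by omega
      exact_mod_cast h
    refine ⟨z, ?_, ?_, hz1, hz2, fun p h1 h2 => ?_⟩
    · by_contra! hlt
      rw [round_eq, ← Int.add_one_le_iff, Int.le_floor] at hlt
      push_cast at hlt
      have hle : √(2 * (n : ℝ) * (n - 2) + 3) ≤ 2 * (n - 2 - z) := by linarith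
      have hsq := (Real.sqrt_le_left (by linarith)).1 hle
      have hstep : 4 * ((z : ℝ) + 1) ^ 2 + 1 ≤ 2 * (n - 2 * z - 3) ^ 2 := by linarith
      have hzn' : z + 1 ≤ (n - 4) / 2 := by
        by_contra! hlast
        have h : (n : ℝ) ≤ 2 * z + 5 := by
          have h : n ≤ 2 * z + 5 := by omega
          exact_mod_cast h
        nlinarith
      have hzn3 : (2 : ℝ) * z + 6 ≤ n := by
        have h : 2 * z + 6 ≤ n := by omega
        exact_mod_cast h
      have hlt' := energyProfile_lt_step (by linarith : (0 : ℝ) < z)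
        (by linarith : (3 : ℝ) ≤ n - 2 * z - 3) hstep
      have hge := hmax (z + 1) (Finset.mem_Icc.2 ⟨by omega, hzn'⟩)
      push_cast at hge
      rw [show (n : ℝ) - 2 * (z + 1) - 3 = n - 2 * z - 3 - 2 by ring] at hge
      linarith
    · by_contra! hlt
      rw [round_eq, Int.floor_lt] at hlt
      push_cast at hlt
      have hle : 2 * (n : ℝ) - 1 - 2 * z < √(2 * (n : ℝ) * (n - 1)) := by linarith
      have hsq := (Real.lt_sqrt (by linarith)).1 hle
      have hstep : 2 * ((n : ℝ) - 2 * z - 1) ^ 2 + 2 * (n - 2 * z - 1) + 1 < 4 * z ^ 2 := by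
        linarith
      have hz2' : 2 ≤ z := by
        by_contra! hone
        obtain rfl : z = 1 := by omega
        push_cast at hstep
        nlinarith
      obtain ⟨y, rfl⟩ : ∃ y, z = y + 1 := ⟨z - 1, by omega⟩
      have hy : (0 : ℝ) < y := by exact_mod_cast (by omega : 0 < y)
      push_cast at hstep hzn
      have hlt' := energyProfile_step_lt hy (by linarith : (3 : ℝ) ≤ n - 2 * y - 3)
        (by linarith)
      have hge := hmax y (Finset.mem_Icc.2 ⟨by omega, by omega⟩)
      push_cast at hge
      rw [show (n : ℝ) - 2 * (y + 1) - 3 = n - 2 * y - 3 - 2 by ring] at hge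
      linarith
    · rw [henergy p h1 h2, henergy z hz1 hz2]
      linarith [hmax p (Finset.mem_Icc.2 ⟨h1, h2⟩)]
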